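/- In the copula-update process, almost surely, for every k ≥ 0 the random function P_k is nondecreasing on ℝ, takes values in [0,1], tends to 0 at −∞ and to 1 at +∞; that is, every iterate of the Gaussian copula update remains a cumulative distribution function. -/

import Mathlib

open MeasureTheory ProbabilityTheory Filter Topology

/-- The standard normal cumulative distribution function `Φ`. -/
noncomputable def Phi (t : ℝ) : ℝ := ((gaussianReal 0 1) (Set.Iic t)).toReal

/-- The inverse (quantile function) of the standard normal CDF. -/
noncomputable def PhiInv (u : ℝ) : ℝ := sInf {x : ℝ | u ≤ Phi x}

/-- The Gaussian copula update function `H_ρ(u,v)`, extended by `H_ρ(0,v) = 0` and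
`H_ρ(1,v) = 1`. -/
noncomputable def Hcop (ρ u v : ℝ) : ℝ :=
  if u = 0 then 0
  else if u = 1 then 1
  else Phi ((PhiInv u - ρ * PhiInv v) / Real.sqrt (1 - ρ ^ 2))

/-- The copula-update process of the martingale posterior construction: an initial random
CDF `P₀`, samples `y_{n+k}` whose conditional probability integral transform
`P_{k−1}(y_{n+k})` is uniform on `[0,1]` given `𝓕_{k−1}`, and the recursive Gaussian
copula update `P_k(y) = (1 − α_{n+k})·P_{k−1}(y) + α_{n+k}·H_ρ(P_{k−1}(y), P_{k−1}(y_{n+k}))`.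
Here `Pk k ω` is the random function `P_k` and `y k` is the random variable `y_{n+k}`. -/
structure CopulaProcess (Ω : Type*) [mΩ : MeasurableSpace Ω] (P : Measure Ω) where
  /-- the copula parameter `ρ ∈ (−1,1)` -/
  ρ : ℝ
  hρ : ρ ∈ Set.Ioo (-1 : ℝ) 1
  /-- the number `n` of originally observed data points -/
  n : ℕ
  hn : 1 ≤ n
  /-- the learning rates: `α (n+k)` is the rate `α_{n+k}` used in step `k` -/
  α : ℕ → ℝ
  hα : ∀ k, 1 ≤ k → α (n + k) ∈ Set.Ioo (0 : ℝ) 1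
  /-- the filtration `(𝓕_k)_{k ≥ 0}` -/
  ℱ : Filtration ℕ mΩ
  /-- `Pk k ω` is the random distribution function `P_k` -/
  Pk : ℕ → Ω → ℝ → ℝ
  /-- `y k` is the random variable `y_{n+k}` (for `k ≥ 1`) -/
  y : ℕ → Ω → ℝ
  /-- `P₀(t)` is `𝓕₀`-measurable for every `t` -/
  meas0 : ∀ t : ℝ, StronglyMeasurable[ℱ 0] fun ω => Pk 0 ω t
  /-- `P₀` is continuous -/
  cont0 : ∀ ω, Continuous (Pk 0 ω)
  /-- `P₀` is strictly increasing -/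
  strictMono0 : ∀ ω, StrictMono (Pk 0 ω)
  /-- `P₀` takes values in `(0,1)` (it is strictly increasing onto `(0,1)`) -/
  mem0 : ∀ ω t, Pk 0 ω t ∈ Set.Ioo (0 : ℝ) 1
  /-- `P₀` has limit `0` at `−∞` -/
  tendsto_atBot0 : ∀ ω, Tendsto (Pk 0 ω) atBot (𝓝 0)
  /-- `P₀` has limit `1` at `+∞` -/
  tendsto_atTop0 : ∀ ω, Tendsto (Pk 0 ω) atTop (𝓝 1)
  /-- `y_{n+k}` is `𝓕_k`-measurable -/
  measy : ∀ k, 1 ≤ k → StronglyMeasurable[ℱ k] (y k)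
  /-- conditionally on `𝓕_{k−1}`, the random variable `P_{k−1}(y_{n+k})` is uniformly
  distributed on `[0,1]` -/
  unif : ∀ k, 1 ≤ k → ∀ A : Set Ω, MeasurableSet[ℱ (k - 1)] A →
    ∀ u ∈ Set.Icc (0 : ℝ) 1,
      P (A ∩ {ω | Pk (k - 1) ω (y k ω) ≤ u}) = P A * ENNReal.ofReal u
  /-- the recursive Gaussian copula update defining `P_k` from `P_{k−1}` -/
  step : ∀ k, 1 ≤ k → ∀ ω t,
    Pk k ω t = (1 - α (n + k)) * Pk (k - 1) ω t
      + α (n + k) * Hcop ρ (Pk (k - 1) ω t) (Pk (k - 1) ω (y k ω))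

lemma Phi_eq_cdf (t : ℝ) : Phi t = cdf (gaussianReal 0 1) t := by
  rw [cdf_eq_real]; rfl

lemma Phi_mono : Monotone Phi := by
  intro a b h
  rw [Phi_eq_cdf, Phi_eq_cdf]
  exact monotone_cdf _ h

lemma tendsto_Phi_atBot : Tendsto Phi atBot (𝓝 0) := by
  rw [funext Phi_eq_cdf]
  exact tendsto_cdf_atBot _

lemma tendsto_Phi_atTop : Tendsto Phi atTop (𝓝 1) := by
  rw [funext Phi_eq_cdf]
  exact tendsto_cdf_atTop _

lemma gaussianReal_ne_zero_of_volume_ne_zero {s : Set ℝ} (hs : volume s ≠ 0) :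
    gaussianReal 0 1 s ≠ 0 :=
  fun h => hs (gaussianReal_absolutelyContinuous' 0 one_ne_zero h)

lemma Phi_mem_Ioo (t : ℝ) : Phi t ∈ Set.Ioo (0 : ℝ) 1 := by
  have pos : ∀ s : Set ℝ, volume s ≠ 0 → 0 < (gaussianReal 0 1).real s := fun s hs =>
    ENNReal.toReal_pos (gaussianReal_ne_zero_of_volume_ne_zero hs) (measure_ne_top _ _)
  refine ⟨pos _ (by simp), ?_⟩
  have h := pos (Set.Iic t)ᶜ (by simp)
  rw [probReal_compl_eq_one_sub measurableSet_Iic] at h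
  exact sub_pos.mp h

lemma bddBelow_setOf_le_Phi {u : ℝ} (hu : 0 < u) : BddBelow {x : ℝ | u ≤ Phi x} := by
  obtain ⟨b, hb⟩ := (tendsto_Phi_atBot.eventually_lt_const hu).exists
  exact ⟨b, fun x hx => (Phi_mono.reflect_lt (hb.trans_le hx)).le⟩

lemma nonempty_setOf_le_Phi {u : ℝ} (hu : u < 1) : {x : ℝ | u ≤ Phi x}.Nonempty := by
  obtain ⟨b, hb⟩ := (tendsto_Phi_atTop.eventually_const_lt hu).exists
  exact ⟨b, hb.le⟩

lemma PhiInv_monotoneOn : MonotoneOn PhiInv (Set.Ioo 0 1) := fun _ ha _ hb hab =>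
  csInf_le_csInf (bddBelow_setOf_le_Phi ha.1) (nonempty_setOf_le_Phi hb.2)
    fun _ hx => hab.trans hx

lemma tendsto_PhiInv_zero : Tendsto PhiInv (𝓝[Set.Ioo 0 1] 0) atBot := by
  refine tendsto_atBot.2 fun b => ?_
  filter_upwards [self_mem_nhdsWithin,
    mem_nhdsWithin_of_mem_nhds (Iio_mem_nhds (Phi_mem_Ioo b).1)] with u hu hub
  exact csInf_le (bddBelow_setOf_le_Phi hu.1) (Set.mem_Iio.1 hub).le

lemma tendsto_PhiInv_one : Tendsto PhiInv (𝓝[Set.Ioo 0 1] 1) atTop := by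
  refine tendsto_atTop.2 fun b => ?_
  filter_upwards [self_mem_nhdsWithin,
    mem_nhdsWithin_of_mem_nhds (Ioi_mem_nhds (Phi_mem_Ioo b).2)] with u hu hub
  exact le_csInf (nonempty_setOf_le_Phi hu.2)
    fun x hx => (Phi_mono.reflect_lt (lt_of_lt_of_le hub hx)).le

lemma Hcop_of_mem_Ioo {u : ℝ} (hu : u ∈ Set.Ioo (0 : ℝ) 1) (ρ v : ℝ) :
    Hcop ρ u v = Phi ((PhiInv u - ρ * PhiInv v) / Real.sqrt (1 - ρ ^ 2)) := by
  rw [Hcop, if_neg hu.1.ne', if_neg hu.2.ne]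

lemma Hcop_mem_Ioo {u : ℝ} (hu : u ∈ Set.Ioo (0 : ℝ) 1) (ρ v : ℝ) :
    Hcop ρ u v ∈ Set.Ioo (0 : ℝ) 1 := by
  rw [Hcop_of_mem_Ioo hu]
  exact Phi_mem_Ioo _

lemma Hcop_monotoneOn (ρ v : ℝ) : MonotoneOn (fun u => Hcop ρ u v) (Set.Ioo 0 1) := by
  intro a ha b hb hab
  simp only [Hcop_of_mem_Ioo ha, Hcop_of_mem_Ioo hb]
  have := PhiInv_monotoneOn ha hb hab
  exact Phi_mono (by gcongr)

lemma sqrt_one_sub_sq_pos {ρ : ℝ} (hρ : ρ ∈ Set.Ioo (-1 : ℝ) 1) :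
    0 < Real.sqrt (1 - ρ ^ 2) :=
  Real.sqrt_pos.2 (by nlinarith [hρ.1, hρ.2])

lemma tendsto_Hcop_zero {ρ : ℝ} (hρ : ρ ∈ Set.Ioo (-1 : ℝ) 1) (v : ℝ) :
    Tendsto (fun u => Hcop ρ u v) (𝓝[Set.Ioo 0 1] 0) (𝓝 0) := by
  refine Tendsto.congr' (eventually_nhdsWithin_of_forall fun u hu =>
    (Hcop_of_mem_Ioo hu ρ v).symm) (tendsto_Phi_atBot.comp ?_)
  exact (tendsto_atBot_add_const_right _ (-(ρ * PhiInv v)) tendsto_PhiInv_zero).atBot_div_const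
    (sqrt_one_sub_sq_pos hρ)

lemma tendsto_Hcop_one {ρ : ℝ} (hρ : ρ ∈ Set.Ioo (-1 : ℝ) 1) (v : ℝ) :
    Tendsto (fun u => Hcop ρ u v) (𝓝[Set.Ioo 0 1] 1) (𝓝 1) := by
  refine Tendsto.congr' (eventually_nhdsWithin_of_forall fun u hu =>
    (Hcop_of_mem_Ioo hu ρ v).symm) (tendsto_Phi_atTop.comp ?_)
  exact (tendsto_atTop_add_const_right _ (-(ρ * PhiInv v)) tendsto_PhiInv_one).atTop_div_const
    (sqrt_one_sub_sq_pos hρ)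

/-- Every iterate of the copula update is, for every `ω`, a distribution function with values
in the open interval `(0,1)`. -/
lemma CopulaProcess.iterate_is_cdf {Ω : Type*} [MeasurableSpace Ω] {P : Measure Ω}
    (Q : CopulaProcess Ω P) (ω : Ω) (k : ℕ) :
    Monotone (Q.Pk k ω) ∧
    (∀ t : ℝ, Q.Pk k ω t ∈ Set.Ioo (0 : ℝ) 1) ∧
    Tendsto (Q.Pk k ω) atBot (𝓝 0) ∧
    Tendsto (Q.Pk k ω) atTop (𝓝 1) := by
  induction k with
  | zero =>
    exact ⟨(Q.strictMono0 ω).monotone, Q.mem0 ω, Q.tendsto_atBot0 ω, Q.tendsto_atTop0 ω⟩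
  | succ k ih =>
    obtain ⟨hmono, hmem, hbot, htop⟩ := ih
    have hk : 1 ≤ k + 1 := k.succ_pos
    obtain ⟨hα0, hα1⟩ := Q.hα (k + 1) hk
    have hstep := Q.step (k + 1) hk ω
    rw [Nat.add_sub_cancel] at hstep
    set a := Q.α (Q.n + (k + 1))
    set v := Q.Pk k ω (Q.y (k + 1) ω)
    have hlim : ∀ {l : Filter ℝ} {c : ℝ}, Tendsto (Q.Pk k ω) l (𝓝 c) →
        Tendsto (fun u => Hcop Q.ρ u v) (𝓝[Set.Ioo 0 1] c) (𝓝 c) →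
        Tendsto (Q.Pk (k + 1) ω) l (𝓝 c) := by
      intro l c h hH
      rw [funext hstep]
      have hH' := hH.comp (tendsto_nhdsWithin_iff.2 ⟨h, Eventually.of_forall hmem⟩)
      have h_sum := (h.const_mul (1 - a)).add (hH'.const_mul a)
      rwa [← add_mul, sub_add_cancel, one_mul] at h_sum
    refine ⟨fun s t hst => ?_, fun t => ?_, hlim hbot (tendsto_Hcop_zero Q.hρ v),
      hlim htop (tendsto_Hcop_one Q.hρ v)⟩
    · rw [hstep, hstep]
      exact add_le_add (mul_le_mul_of_nonneg_left (hmono hst) (sub_nonneg.2 hα1.le))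
        (mul_le_mul_of_nonneg_left
          (Hcop_monotoneOn Q.ρ v (hmem s) (hmem t) (hmono hst)) hα0.le)
    · rw [hstep]
      exact convex_Ioo (0 : ℝ) 1 (hmem t) (Hcop_mem_Ioo (hmem t) Q.ρ v)
        (sub_nonneg.2 hα1.le) hα0.le (sub_add_cancel 1 a)

/-- In the copula-update process, almost surely every iterate `P_k` remains a cumulative
distribution function: it is nondecreasing, takes values in `[0,1]`, tends to `0` at `−∞`
and to `1` at `+∞`. -/
theorem copulaProcess_iterates_are_cdf {Ω : Type*} [mΩ : MeasurableSpace Ω]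
    (P : Measure Ω) [IsProbabilityMeasure P] (Q : CopulaProcess Ω P) :
    ∀ᵐ ω ∂P, ∀ k : ℕ,
      Monotone (Q.Pk k ω) ∧
      (∀ t : ℝ, Q.Pk k ω t ∈ Set.Icc (0 : ℝ) 1) ∧
      Tendsto (Q.Pk k ω) atBot (𝓝 0) ∧
      Tendsto (Q.Pk k ω) atTop (𝓝 1) := by
  refine ae_of_all _ fun ω k => ?_
  obtain ⟨hmono, hmem, hlim⟩ := Q.iterate_is_cdf ω k
  exact ⟨hmono, fun t => Set.Ioo_subset_Icc_self (hmem t), hlim⟩
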